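/- Let N = (P,T,F) be a nonredundant workflow net that is k-sound but i-unsound for all 1 ≤ i < k. Let c be a constant such that every natural solution μ of the ILP with constraints {i:κ} + Σ_t τ_t·Δ(t) = {f:κ}, τ ≥ 0, κ ≥ 1, admits a natural solution μ' ≤ μ with all components at most c. Then k ≤ c + (‖T‖+2)^{|T|} · max(‖T‖, c) · |P|(|P|+2). -/

import Mathlib

/-- A Petri net over places `P` and transitions `T`, given by pre/post arc weights. -/
structure PetriNet (P T : Type) where
  pre : T → P → ℕ
  post : T → P → ℕ

namespace PetriNet

variable {P T : Type}

/-- Transition `t` is enabled in marking `m`. -/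
def Enabled (N : PetriNet P T) (m : P → ℕ) (t : T) : Prop := ∀ p, N.pre t p ≤ m p

/-- Firing transition `t` in `m` yields `m'`. -/
def Fire (N : PetriNet P T) (m : P → ℕ) (t : T) (m' : P → ℕ) : Prop :=
  N.Enabled m t ∧ ∀ p, m' p = m p - N.pre t p + N.post t p

def Step (N : PetriNet P T) (m m' : P → ℕ) : Prop := ∃ t, N.Fire m t m'

/-- Reachability `m →* m'`. -/
def Reach (N : PetriNet P T) : (P → ℕ) → (P → ℕ) → Prop := Relation.ReflTransGen N.Step

/-- Effect of a transition, as an integer vector. -/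
def eff (N : PetriNet P T) (t : T) (p : P) : ℤ := (N.post t p : ℤ) - (N.pre t p : ℤ)

def ZStep (N : PetriNet P T) (m m' : P → ℤ) : Prop := ∃ t, ∀ p, m' p = m p + N.eff t p

/-- Z-reachability: no enabledness constraint, markings range over ℤ. -/
def ZReach (N : PetriNet P T) : (P → ℤ) → (P → ℤ) → Prop := Relation.ReflTransGen N.ZStep

/-- Maximal arc weight `‖T‖`. -/
def maxW (N : PetriNet P T) [Fintype P] [Fintype T] : ℕ :=
  Finset.univ.sup fun t => Finset.univ.sup fun p => max (N.pre t p) (N.post t p)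

/-- Edge relation of the underlying graph, on `P ⊕ T`. -/
def Edge (N : PetriNet P T) : (P ⊕ T) → (P ⊕ T) → Prop
  | Sum.inl p, Sum.inr t => 0 < N.pre t p
  | Sum.inr t, Sum.inl p => 0 < N.post t p
  | _, _ => False

/-- `N` is bounded from marking `m`. -/
def BoundedFrom (N : PetriNet P T) (m : P → ℕ) : Prop :=
  ∃ b : ℕ, ∀ m', N.Reach m m' → ∀ p, m' p ≤ b

/-- `N` is cyclic from marking `m`. -/
def CyclicFrom (N : PetriNet P T) (m : P → ℕ) : Prop :=
  ∀ m', N.Reach m m' → N.Reach m' m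

/-- Transition `t` is quasi-live from `m`. -/
def QuasiLiveT (N : PetriNet P T) (m : P → ℕ) (t : T) : Prop :=
  ∃ m', N.Reach m m' ∧ N.Enabled m' t

/-- `N` is quasi-live from `m`. -/
def QuasiLiveFrom (N : PetriNet P T) (m : P → ℕ) : Prop :=
  ∀ t, N.QuasiLiveT m t

/-- Transition `t` is live from `m`. -/
def LiveT (N : PetriNet P T) (m : P → ℕ) (t : T) : Prop :=
  ∀ m', N.Reach m m' → N.QuasiLiveT m' t

end PetriNet

/-- A workflow net: a Petri net with initial place `ini`, final place `fin`,
no production into `ini`, no consumption from `fin`, and every node on a path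
from `ini` to `fin` in the underlying graph. -/
structure WorkflowNet (P T : Type) extends PetriNet P T where
  ini : P
  fin : P
  ini_ne_fin : ini ≠ fin
  no_prod_ini : ∀ t, post t ini = 0
  no_cons_fin : ∀ t, pre t fin = 0
  on_path : ∀ v : P ⊕ T,
    Relation.ReflTransGen toPetriNet.Edge (Sum.inl ini) v ∧
    Relation.ReflTransGen toPetriNet.Edge v (Sum.inl fin)

namespace WorkflowNet

variable {P T : Type}

/-- The marking `{i : k}`. -/
def iniM [DecidableEq P] (N : WorkflowNet P T) (k : ℕ) : P → ℕ :=
  fun p => if p = N.ini then k else 0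

/-- The marking `{f : k}`. -/
def finM [DecidableEq P] (N : WorkflowNet P T) (k : ℕ) : P → ℕ :=
  fun p => if p = N.fin then k else 0

/-- `N` is `k`-sound. -/
def KSound [DecidableEq P] (N : WorkflowNet P T) (k : ℕ) : Prop :=
  ∀ m, N.toPetriNet.Reach (N.iniM k) m → N.toPetriNet.Reach m (N.finM k)

/-- `N` is generalised sound. -/
def GeneralisedSound [DecidableEq P] (N : WorkflowNet P T) : Prop :=
  ∀ k : ℕ, 1 ≤ k → N.KSound k

/-- `N` is structurally sound. -/
def StructurallySound [DecidableEq P] (N : WorkflowNet P T) : Prop :=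
  ∃ k : ℕ, 1 ≤ k ∧ N.KSound k

/-- All places of `N` are nonredundant. -/
def Nonredundant [DecidableEq P] (N : WorkflowNet P T) : Prop :=
  ∀ p : P, ∃ (k : ℕ) (m : P → ℕ), N.toPetriNet.Reach (N.iniM k) m ∧ 0 < m p

/-- `N` is strongly `k`-sound. -/
def StronglyKSound [DecidableEq P] (N : WorkflowNet P T) (k : ℕ) : Prop :=
  ∀ m : P → ℕ,
    N.toPetriNet.ZReach (fun p => ((N.iniM k) p : ℤ)) (fun p => (m p : ℤ)) →
    N.toPetriNet.Reach m (N.finM k)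

end WorkflowNet

section ILPS

variable {P T : Type} [DecidableEq P] [Fintype P] [Fintype T]

/-- `(κ, τ)` is a natural solution of ILP_N^s: the transitions' total effect
takes `{i:κ}` to `{f:κ}`, and `κ ≥ 1`. -/
def IsSolILPs (N : WorkflowNet P T) (κ : ℕ) (τ : T → ℕ) : Prop :=
  1 ≤ κ ∧
  ∀ p : P, ((N.iniM κ) p : ℤ) + ∑ t, (τ t : ℤ) * N.toPetriNet.eff t p =
    ((N.finM κ) p : ℤ)

end ILPS

namespace PetriNet

variable {P T : Type} {N : PetriNet P T}

theorem Step.add_right {m m' : P → ℕ} (h : N.Step m m') (u : P → ℕ) :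
    N.Step (m + u) (m' + u) := by
  obtain ⟨t, hen, heq⟩ := h
  refine ⟨t, fun p => (hen p).trans (Nat.le_add_right _ _), fun p => ?_⟩
  have := hen p
  have := heq p
  simp only [Pi.add_apply]
  omega

theorem Reach.refl {m : P → ℕ} : N.Reach m m := Relation.ReflTransGen.refl

theorem Reach.trans {m₁ m₂ m₃ : P → ℕ} (h : N.Reach m₁ m₂) (h' : N.Reach m₂ m₃) :
    N.Reach m₁ m₃ := Relation.ReflTransGen.trans h h'

theorem Reach.add_right {m m' : P → ℕ} (h : N.Reach m m') (u : P → ℕ) :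
    N.Reach (m + u) (m' + u) := by
  induction h with
  | refl => exact .refl
  | tail _ hs ih => exact .tail ih (hs.add_right u)

theorem step_add_pre_add_post (t : T) (u : P → ℕ) : N.Step (u + N.pre t) (u + N.post t) :=
  ⟨t, fun p => Nat.le_add_left _ _, fun p => by simp⟩

theorem reach_nsmul (t : T) (n : ℕ) (u : P → ℕ) :
    N.Reach (u + n • N.pre t) (u + n • N.post t) := by
  induction n generalizing u with
  | zero => simpa using Reach.refl (m := u)
  | succ n ih =>
    have hs : N.Step (u + (n + 1) • N.pre t) (u + N.post t + n • N.pre t) := by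
      have := N.step_add_pre_add_post t (u + n • N.pre t)
      rwa [add_assoc, ← succ_nsmul, add_right_comm] at this
    have := ih (u + N.post t)
    rw [add_assoc u _ (n • N.post t), ← succ_nsmul'] at this
    exact .head hs this

theorem reach_sum_nsmul (s : Finset T) (τ : T → ℕ) (u : P → ℕ) :
    N.Reach (u + ∑ t ∈ s, τ t • N.pre t) (u + ∑ t ∈ s, τ t • N.post t) := by
  classical
  induction s using Finset.induction_on generalizing u with
  | empty => simpa using Reach.refl (m := u)
  | insert t s ht ih =>
    rw [Finset.sum_insert ht, Finset.sum_insert ht]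
    have h₁ := N.reach_nsmul t (τ t) (u + ∑ x ∈ s, τ x • N.pre x)
    have h₂ := ih (u + τ t • N.post t)
    rw [add_right_comm] at h₁
    rw [add_right_comm u (∑ x ∈ s, τ x • N.pre x)] at h₁
    rw [← add_assoc, ← add_assoc]
    exact h₁.trans h₂

/-- The marking equation: a run changes the marking by the effects of its transitions. -/
theorem Reach.exists_firing_count [Fintype T] {m m' : P → ℕ} (h : N.Reach m m') :
    ∃ τ : T → ℕ, ∀ p, (m p : ℤ) + ∑ t, (τ t : ℤ) * N.eff t p = m' p := by
  classical
  induction h with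
  | refl => exact ⟨0, by simp⟩
  | tail _ hs ih =>
    obtain ⟨τ, hτ⟩ := ih
    obtain ⟨t, hen, heq⟩ := hs
    refine ⟨τ + Pi.single t 1, fun p => ?_⟩
    have hsum : ∑ x, ((Pi.single t 1 : T → ℕ) x : ℤ) * N.eff x p = N.eff t p := by
      simp [Pi.single_apply]
    have := hτ p
    have := hen p
    have := heq p
    simp only [Pi.add_apply, Nat.cast_add, add_mul, Finset.sum_add_distrib, hsum]
    unfold eff at *
    omega

theorem pre_le_maxW [Fintype P] [Fintype T] (t : T) (p : P) : N.pre t p ≤ N.maxW :=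
  (le_max_left _ _).trans <|
    (Finset.le_sup (f := fun p => max (N.pre t p) (N.post t p)) (Finset.mem_univ p)).trans <|
      Finset.le_sup (f := fun t => Finset.univ.sup fun p => max (N.pre t p) (N.post t p))
        (Finset.mem_univ t)

end PetriNet

namespace WorkflowNet

variable {P T : Type} [DecidableEq P] {N : WorkflowNet P T}

theorem iniM_add (a b : ℕ) : N.iniM (a + b) = N.iniM a + N.iniM b := by
  ext p
  by_cases h : p = N.ini <;> simp [iniM, h]

theorem finM_add (a b : ℕ) : N.finM (a + b) = N.finM a + N.finM b := by
  ext p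
  by_cases h : p = N.fin <;> simp [finM, h]

/-- Tokens in the final place are never consumed, so they can be removed from a run. -/
theorem reach_of_reach_add_finM {m w : P → ℕ} {b : ℕ}
    (h : N.toPetriNet.Reach (m + N.finM b) w) :
    ∃ w', w = w' + N.finM b ∧ N.toPetriNet.Reach m w' := by
  induction h with
  | refl => exact ⟨m, rfl, .refl⟩
  | tail _ hs ih =>
    obtain ⟨v, rfl, hv⟩ := ih
    obtain ⟨t, hen, heq⟩ := hs
    have hen' : N.toPetriNet.Enabled v t := fun p => by
      by_cases hp : p = N.fin
      · subst hp
        simp [N.no_cons_fin]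
      · simpa [finM, hp] using hen p
    refine ⟨fun p => v p - N.pre t p + N.post t p, ?_, .tail hv ⟨t, hen', fun p => rfl⟩⟩
    ext p
    have := hen' p
    have := heq p
    simp only [Pi.add_apply] at *
    omega

theorem reach_finM_of_reach_add_finM {m : P → ℕ} {a b : ℕ}
    (h : N.toPetriNet.Reach (m + N.finM b) (N.finM (a + b))) :
    N.toPetriNet.Reach m (N.finM a) := by
  obtain ⟨w, hw, hr⟩ := reach_of_reach_add_finM h
  rw [finM_add, add_left_inj] at hw
  rwa [hw]

theorem KSound.of_reach {a b : ℕ} (h : N.KSound (a + b))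
    (hr : N.toPetriNet.Reach (N.iniM (a + b)) (N.iniM a + N.finM b)) : N.KSound a :=
  fun _ hm => reach_finM_of_reach_add_finM (h _ (hr.trans (hm.add_right _)))

/-- In a nonredundant net, a set of places containing the initial one and everything produced by
the transitions outside `S` covers the preset of some transition in `S`. -/
theorem Nonredundant.exists_pre_subset (hN : N.Nonredundant) {S : Finset T} (hS : S.Nonempty)
    {X : Set P} (hi : N.ini ∈ X) (hX : ∀ t ∉ S, ∀ p, 0 < N.post t p → p ∈ X) :
    ∃ t ∈ S, ∀ p, 0 < N.pre t p → p ∈ X := by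
  by_contra! hcon
  have hsupp : ∀ k m, N.toPetriNet.Reach (N.iniM k) m → ∀ p, 0 < m p → p ∈ X := by
    intro k m h
    induction h with
    | refl =>
      intro p hp
      by_cases h : p = N.ini
      · rwa [h]
      · simp [iniM, h] at hp
    | tail _ hs ih =>
      obtain ⟨t, hen, heq⟩ := hs
      have ht : t ∉ S := fun ht => by
        obtain ⟨q, hq, hqX⟩ := hcon t ht
        exact hqX (ih q (hq.trans_le (hen q)))
      intro p hp
      rcases Nat.eq_zero_or_pos (N.post t p) with h0 | h0
      · exact ih p (by have := heq p; omega)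
      · exact hX t ht p h0
  obtain ⟨t, ht⟩ := hS
  obtain ⟨p, -, hp⟩ := hcon t ht
  obtain ⟨k, m, hm, hmp⟩ := hN p
  exact hp (hsupp k m hm p hmp)

/-- A marking with enough tokens on a suitable set of places reaches one from which every
transition of `S` can be fired `c` times. -/
theorem Nonredundant.exists_reach_ge [Fintype P] [Fintype T] (hN : N.Nonredundant) (c : ℕ)
    (S : Finset T) {X : Set P} (hi : N.ini ∈ X)
    (hX : ∀ t ∉ S, ∀ p, 0 < N.post t p → p ∈ X) {m : P → ℕ}
    (hm : ∀ p ∈ X, c * (N.maxW + 1) ^ S.card ≤ m p + c) :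
    ∃ m', N.toPetriNet.Reach m m' ∧ ∀ p, c * ∑ t ∈ S, N.pre t p ≤ m' p := by
  classical
  induction hn : S.card generalizing S X m with
  | zero =>
    obtain rfl := Finset.card_eq_zero.mp hn
    exact ⟨m, .refl, by simp⟩
  | succ n ih =>
    obtain ⟨t, htS, htX⟩ :=
      hN.exists_pre_subset (Finset.card_pos.mp (by omega)) hi hX
    have hcard : (S.erase t).card = n := by rw [Finset.card_erase_of_mem htS, hn]; rfl
    set A := (N.maxW + 1) ^ n with hA
    have hA1 : 1 ≤ A := Nat.one_le_pow _ _ (Nat.succ_pos _)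
    -- `y` firings of `t`, with `c` further presets of `t` put aside
    obtain ⟨y, hy⟩ : ∃ y, c * A = y + c := ⟨c * A - c, by
      have := Nat.mul_le_mul_left c hA1
      omega⟩
    have hfat : ∀ p ∈ X, c * A + c * A * N.maxW ≤ m p + c := fun p hp => by
      have := hm p hp
      rw [hn, pow_succ, ← hA] at this
      linarith
    have hmp : ∀ p ∈ X, y + (y + c) * N.pre t p ≤ m p := fun p hp => by
      have h₁ := hfat p hp
      have h₂ : (y + c) * N.pre t p ≤ (y + c) * N.maxW :=
        Nat.mul_le_mul_left _ (PetriNet.pre_le_maxW t p)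
      rw [hy] at h₁
      omega
    have hle : ∀ p, (y + c) * N.pre t p ≤ m p := fun p => by
      rcases Nat.eq_zero_or_pos (N.pre t p) with h0 | h0
      · simp [h0]
      · have := hmp p (htX p h0)
        omega
    obtain ⟨u, rfl⟩ : ∃ u, m = u + (y + c) • N.pre t :=
      ⟨fun p => m p - (y + c) * N.pre t p, by
        ext p
        have := hle p
        simp only [Pi.add_apply, Pi.smul_apply, smul_eq_mul]
        omega⟩
    obtain ⟨m', hr, hm'⟩ := ih (S.erase t) (X := X ∪ {p | 0 < N.post t p})
      (m := u + y • N.post t) (Or.inl hi)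
      (fun s hs p hp => by
        by_cases hst : s = t
        · exact Or.inr (hst ▸ hp)
        · exact Or.inl (hX s (fun h => hs (Finset.mem_erase.mpr ⟨hst, h⟩)) p hp))
      (fun p hp => by
        rw [hcard, ← hA, hy]
        simp only [Pi.add_apply, Pi.smul_apply, smul_eq_mul]
        rcases hp with hp | hp
        · have := hmp p hp
          simp only [Pi.add_apply, Pi.smul_apply, smul_eq_mul] at this
          omega
        · have := Nat.le_mul_of_pos_right y hp
          omega)
      hcard
    refine ⟨m' + c • N.pre t, ?_, fun p => ?_⟩
    · have h := N.reach_nsmul t y (u + c • N.pre t)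
      rw [add_assoc, ← add_nsmul, add_comm c y, add_right_comm] at h
      exact h.trans (hr.add_right _)
    · have := hm' p
      rw [← Finset.sum_erase_add _ _ htS, mul_add]
      simpa using this

end WorkflowNet

section Solutions

variable {P T : Type} [DecidableEq P] [Fintype T] {N : WorkflowNet P T}

theorem IsSolILPs.of_reach {k : ℕ} (hk : 1 ≤ k)
    (h : N.toPetriNet.Reach (N.iniM k) (N.finM k)) : ∃ τ, IsSolILPs N k τ :=
  let ⟨τ, hτ⟩ := h.exists_firing_count
  ⟨τ, hk, hτ⟩

theorem IsSolILPs.reach {κ : ℕ} {τ : T → ℕ} (h : IsSolILPs N κ τ) {m : P → ℕ}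
    (hm : ∀ p, ∑ t, τ t * N.pre t p ≤ m p) :
    N.toPetriNet.Reach (m + N.iniM κ) (m + N.finM κ) := by
  obtain ⟨u, rfl⟩ : ∃ u, m = u + ∑ t, τ t • N.pre t :=
    ⟨fun p => m p - ∑ t, τ t * N.pre t p, by
      ext p
      have := hm p
      simp only [Pi.add_apply, Finset.sum_apply, Pi.smul_apply, smul_eq_mul]
      omega⟩
  have hr := (N.reach_sum_nsmul Finset.univ τ u).add_right (N.iniM κ)
  convert hr using 1
  ext p
  have := h.2 p
  simp only [PetriNet.eff, mul_sub, Finset.sum_sub_distrib] at this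
  zify
  simp only [Pi.add_apply, Finset.sum_apply, Pi.smul_apply, smul_eq_mul, Nat.cast_add,
    Nat.cast_sum, Nat.cast_mul]
  linarith

theorem IsSolILPs.reach_mul {κ : ℕ} {τ : T → ℕ} (h : IsSolILPs N κ τ) {m : P → ℕ}
    (hm : ∀ p, ∑ t, τ t * N.pre t p ≤ m p) (j : ℕ) :
    N.toPetriNet.Reach (m + N.iniM (j * κ)) (m + N.finM (j * κ)) := by
  induction j with
  | zero =>
    have : N.iniM (0 * κ) = N.finM (0 * κ) := by ext p; simp [WorkflowNet.iniM, WorkflowNet.finM]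
    rw [this]
    exact .refl
  | succ j ih =>
    rw [add_mul, one_mul, WorkflowNet.iniM_add, WorkflowNet.finM_add]
    have h₁ := ih.add_right (N.iniM κ)
    have h₂ := (h.reach hm).add_right (N.finM (j * κ))
    rw [add_right_comm m (N.iniM κ), add_right_comm m (N.finM κ)] at h₂
    rw [← add_assoc, ← add_assoc]
    exact h₁.trans h₂

end Solutions

section ILPS

variable {P T : Type} [DecidableEq P] [Fintype P] [Fintype T]

/-- The first sound number is bounded via small solutions of ILP_N^s. -/
theorem first_sound_small (N : WorkflowNet P T) (hN : N.Nonredundant)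
    (k : ℕ) (hk : N.KSound k) (hbelow : ∀ i : ℕ, 1 ≤ i → i < k → ¬ N.KSound i)
    (c : ℕ)
    (hc : ∀ (κ : ℕ) (τ : T → ℕ), IsSolILPs N κ τ →
      ∃ (κ' : ℕ) (τ' : T → ℕ), IsSolILPs N κ' τ' ∧
        κ' ≤ κ ∧ (∀ t, τ' t ≤ τ t) ∧ κ' ≤ c ∧ ∀ t, τ' t ≤ c) :
    k ≤ c + (N.toPetriNet.maxW + 2) ^ (Fintype.card T) *
      max N.toPetriNet.maxW c * (Fintype.card P * (Fintype.card P + 2)) := by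
  rcases Nat.eq_zero_or_pos k with rfl | hkpos
  · exact Nat.zero_le _
  obtain ⟨τ, hτ⟩ := IsSolILPs.of_reach hkpos (hk _ .refl)
  obtain ⟨κ, τ', hsol, -, -, hκc, hτc⟩ := hc k τ hτ
  have hκ : 1 ≤ κ := hsol.1
  by_contra! hlt
  set l := c * (N.toPetriNet.maxW + 1) ^ Fintype.card T with hl
  have hlpos : 1 ≤ l := Nat.mul_pos (hκ.trans hκc) (Nat.pow_pos (Nat.succ_pos _))
  have hlB : l ≤ (N.toPetriNet.maxW + 2) ^ (Fintype.card T) *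
      max N.toPetriNet.maxW c * (Fintype.card P * (Fintype.card P + 2)) := by
    have hP : 1 ≤ Fintype.card P := Fintype.card_pos_iff.mpr ⟨N.ini⟩
    calc l = (N.toPetriNet.maxW + 1) ^ Fintype.card T * c * 1 := by rw [hl]; ring
      _ ≤ _ := by
        gcongr
        · omega
        · exact le_max_right _ _
        · exact Nat.mul_pos hP (by omega)
  obtain ⟨m, hr, hm⟩ := hN.exists_reach_ge c Finset.univ (X := {N.ini}) rfl (by simp)
    (m := N.iniM l) (by
      rintro p rfl
      simp [WorkflowNet.iniM, hl])
  have hm' : ∀ p, ∑ t, τ' t * N.pre t p ≤ m p := fun p =>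
    (Finset.sum_le_sum fun t _ => Nat.mul_le_mul_right _ (hτc t)).trans
      ((Finset.mul_sum _ _ _).symm.le.trans (hm p))
  obtain ⟨j, r, hj, hk_eq⟩ : ∃ j r, 1 ≤ j ∧ k = l + r + j * κ := by
    refine ⟨(k - l) / κ, (k - l) % κ, (Nat.one_le_div_iff hκ).mpr (by omega), ?_⟩
    have := Nat.mod_add_div' (k - l) κ
    omega
  subst hk_eq
  -- the markings `m` and `{i:r}` can be completed on their own
  have hfin : N.toPetriNet.Reach (m + N.iniM r) (N.finM (l + r)) := by
    refine WorkflowNet.reach_finM_of_reach_add_finM (b := j * κ) (hk _ ?_)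
    rw [WorkflowNet.iniM_add, WorkflowNet.iniM_add, add_right_comm, add_right_comm m]
    exact ((hr.add_right _).trans (hsol.reach_mul hm' j)).add_right _
  have hsound : N.KSound (j * κ) := by
    rw [add_comm] at hk
    refine hk.of_reach ?_
    rw [WorkflowNet.iniM_add, WorkflowNet.iniM_add l r, add_comm, add_comm (N.iniM (j * κ))]
    exact ((hr.add_right _).trans hfin).add_right _
  exact hbelow _ (Nat.mul_pos hj hκ) (by omega) hsound

end ILPS
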